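/- arXiv:1507.08554 — 3 statements merged into one kernel-verified Lean document; each statement's English description precedes it below -/
import Mathlib

section
/- Gaussian representation of a squared coordinate of a uniform point on the sphere: Let n ≥ 1, let Y be distributed according to the uniform (Haar) probability measure μ on S^{n-1}, and let ζ_1, …, ζ_n be i.i.d. standard normal random variables. Then for every 1 ≤ i ≤ n, the law of Y[i]^2 equals the law of ζ_1^2 / (Σ_{k=1}^n ζ_k^2). -/
open MeasureTheory ProbabilityTheory

noncomputable section

/-- The unit sphere `S^{n-1} = {x ∈ ℝ^n : ∑ i, x i ^ 2 = 1}`. -/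
def unitSphere (n : ℕ) : Set (Fin n → ℝ) := {x | ∑ i, x i ^ 2 = 1}

/-- An orthogonal matrix with prescribed unit `i`-th row, which preserves the Gaussian. -/
theorem exists_orth (n : ℕ) (u : Fin n → ℝ) (hu : ∑ k, u k ^ 2 = 1) (i : Fin n) :
    ∃ O : Matrix.orthogonalGroup (Fin n) ℝ,
      (∀ z, Matrix.mulVec (O : Matrix (Fin n) (Fin n) ℝ) z i = ∑ k, u k * z k) ∧
      (∀ z, ∑ k, (Matrix.mulVec (O : Matrix (Fin n) (Fin n) ℝ) z k) ^ 2 = ∑ k, z k ^ 2) ∧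
      Measure.map (fun x => Matrix.mulVec (O : Matrix (Fin n) (Fin n) ℝ) x)
        (Measure.pi fun _ : Fin n => gaussianReal 0 1) =
        (Measure.pi fun _ : Fin n => gaussianReal 0 1) := by
  have hn : ‖(WithLp.toLp 2 u : EuclideanSpace ℝ (Fin n))‖ = 1 := by
    rw [EuclideanSpace.norm_eq]
    simp [hu]
  obtain ⟨b, hb⟩ := Orthonormal.exists_orthonormalBasis_extension_of_card_eq
    (𝕜 := ℝ) (E := EuclideanSpace ℝ (Fin n)) (ι := Fin n) (by simp)
    (v := fun _ => WithLp.toLp 2 u) (s := {i}) (by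
      refine ⟨fun _ => hn, fun a c hac => ?_⟩
      exact absurd (Subsingleton.elim a c) hac)
  have hbi := hb i rfl
  let M : Matrix (Fin n) (Fin n) ℝ := Matrix.of fun j k => b j k
  have hM : M ∈ Matrix.orthogonalGroup (Fin n) ℝ := by
    rw [Matrix.mem_orthogonalGroup_iff]
    ext j k
    have h := (orthonormal_iff_ite.mp b.orthonormal) j k
    rw [Matrix.mul_apply, Matrix.one_apply, ← h]
    simp [M, PiLp.inner_apply, mul_comm]
  have hrepr : ∀ z : Fin n → ℝ, M.mulVec z = WithLp.ofLp (b.repr (WithLp.toLp 2 z)) := by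
    intro z
    ext j
    rw [b.repr_apply_apply]
    simp [M, Matrix.mulVec, dotProduct, PiLp.inner_apply, mul_comm]
  refine ⟨⟨M, hM⟩, ?_, ?_, ?_⟩
  · intro z
    simp [M, Matrix.mulVec, dotProduct, hbi]
  · intro z
    have h := b.repr.norm_map (WithLp.toLp 2 z)
    have h2 := congrArg (fun t => t ^ 2) h
    simp only [EuclideanSpace.real_norm_sq_eq] at h2
    simp only [hrepr]
    exact h2
  · have h1 := map_pi_eq_stdGaussian (ι := Fin n)
    have h2 := stdGaussian_map b.repr
    have hf : (fun x : Fin n → ℝ => M.mulVec x) =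
        (WithLp.ofLp : EuclideanSpace ℝ (Fin n) → _) ∘ (b.repr ∘ WithLp.toLp 2) := by
      funext x; exact hrepr x
    simp only
    rw [hf, ← Measure.map_map (by fun_prop) (by fun_prop),
      ← Measure.map_map (by fun_prop) (by fun_prop), h1, h2, ← h1,
      Measure.map_map (by fun_prop) (by fun_prop)]
    exact Measure.map_id

/-- Gaussian representation of a squared coordinate of a uniform point on the sphere:
if `Y` is distributed according to the uniform (Haar) probability measure on `S^{n-1}`
(characterized as a rotation-invariant probability measure supported on the sphere) and
`ζ_1, …, ζ_n` are i.i.d. standard normals, then `L(Y i ²) = L(ζ_1² / ∑ k ζ_k²)`. -/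
theorem sphere_coordinate_gaussian_representation (n : ℕ) (hn : 0 < n)
    (μ : Measure (Fin n → ℝ)) [IsProbabilityMeasure μ]
    (hsupp : μ (unitSphere n)ᶜ = 0)
    (hinv : ∀ O : Matrix.orthogonalGroup (Fin n) ℝ,
      Measure.map (fun x => Matrix.mulVec (O : Matrix (Fin n) (Fin n) ℝ) x) μ = μ)
    (i : Fin n) :
    Measure.map (fun y : Fin n → ℝ => y i ^ 2) μ =
      Measure.map (fun ζ : Fin n → ℝ => ζ ⟨0, hn⟩ ^ 2 / ∑ k, ζ k ^ 2)
        (Measure.pi fun _ : Fin n => gaussianReal 0 1) := by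
  classical
  set γ : Measure (Fin n → ℝ) := Measure.pi fun _ : Fin n => gaussianReal 0 1 with hγ
  ext A hA
  rw [Measure.map_apply (by fun_prop) hA, Measure.map_apply (by fun_prop) hA]
  let T : (Fin n → ℝ) × (Fin n → ℝ) → ℝ :=
    fun p => (∑ k, p.1 k * p.2 k) ^ 2 / ∑ k, p.2 k ^ 2
  have hT : Measurable T := by fun_prop
  have hS := hT hA
  have e1 := Measure.prod_apply (μ := μ) (ν := γ) hS
  have e2 := Measure.prod_apply_symm (μ := μ) (ν := γ) hS
  rw [e1] at e2
  have hy : ∀ᵐ y ∂μ, y ∈ unitSphere n := by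
    rw [ae_iff]; exact hsupp
  have hz : ∀ᵐ z ∂γ, z ⟨0, hn⟩ ≠ 0 := by
    have hq : MeasurePreserving (Function.eval (⟨0, hn⟩ : Fin n)) γ (gaussianReal 0 1) :=
      measurePreserving_eval _ _
    have : NullSingletonClass (gaussianReal 0 1) := nullSingletonClass_gaussianReal (by norm_num)
    have h0 : ∀ᵐ x ∂(gaussianReal 0 1), x ≠ 0 := by
      rw [ae_iff]; simp [measure_singleton]
    exact hq.quasiMeasurePreserving.ae h0
  have l1 : ∫⁻ y, γ (Prod.mk y ⁻¹' (T ⁻¹' A)) ∂μ =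
      γ ((fun ζ : Fin n → ℝ => ζ ⟨0, hn⟩ ^ 2 / ∑ k, ζ k ^ 2) ⁻¹' A) := by
    rw [lintegral_congr_ae (g := fun _ =>
      γ ((fun ζ : Fin n → ℝ => ζ ⟨0, hn⟩ ^ 2 / ∑ k, ζ k ^ 2) ⁻¹' A))]
    · simp
    filter_upwards [hy] with y hy
    obtain ⟨O, h1, h2, h3⟩ := exists_orth n y hy ⟨0, hn⟩
    conv_rhs => rw [hγ, ← h3]
    rw [Measure.map_apply (by fun_prop) ((by fun_prop :
      Measurable (fun ζ : Fin n → ℝ => ζ ⟨0, hn⟩ ^ 2 / ∑ k, ζ k ^ 2)) hA)]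
    congr 1
    ext z
    simp only [Set.mem_preimage, h1, h2, T]
  have l2 : ∫⁻ z, μ ((fun y => (y, z)) ⁻¹' (T ⁻¹' A)) ∂γ =
      μ ((fun y : Fin n → ℝ => y i ^ 2) ⁻¹' A) := by
    rw [lintegral_congr_ae (g := fun _ => μ ((fun y : Fin n → ℝ => y i ^ 2) ⁻¹' A))]
    · simp
    filter_upwards [hz] with z hz
    have hpos : 0 < ∑ k, z k ^ 2 :=
      Finset.sum_pos' (fun k _ => sq_nonneg _) ⟨⟨0, hn⟩, Finset.mem_univ _, by positivity⟩
    have hsq := Real.sq_sqrt hpos.le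
    obtain ⟨O, h1, -, -⟩ := exists_orth n (fun k => z k / √(∑ k, z k ^ 2)) (by
      simp only [div_pow, hsq, ← Finset.sum_div]
      exact div_self hpos.ne') i
    conv_rhs => rw [← hinv O]
    rw [Measure.map_apply (by fun_prop) ((by fun_prop :
      Measurable (fun y : Fin n → ℝ => y i ^ 2)) hA)]
    congr 1
    ext y
    simp only [Set.mem_preimage, h1, T]
    have : ∑ k, z k / √(∑ k, z k ^ 2) * y k = (∑ k, y k * z k) / √(∑ k, z k ^ 2) := by
      rw [Finset.sum_div]
      exact Finset.sum_congr rfl fun k _ => by ring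
    rw [this, div_pow, hsq]
  rw [← l2, ← e2, l1]

end
end

section
/- Coupling success lemma (Lemma 4.3): Fix positive reals 1 < p < q' < q/2 and set c = min(q'/2, q − 2q') > 0. There exists N0(p, q, q') such that for all n > N0(p, q, q') the following holds. Let A, B, C, D be reals with 0 ≤ A, B, C, D ≤ 1, |A − C| ≤ n^{−q}, |B − D| ≤ n^{−q}, and B, D ≥ n^{−p}. Then there exists a probability measure π on [0, 2π) × [0, 2π) whose two marginals are each the uniform distribution on [0, 2π), such that π-almost surely cos(θ)·cos(θ') ≥ 0 and sin(θ)·sin(θ') ≥ 0, and π({ (θ, θ') : A + B·cos(θ)^2 = C + D·cos(θ')^2 }) ≥ 1 − 6·10^3·n^{−c}. -/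
open MeasureTheory
open scoped ENNReal

noncomputable section

/-- The uniform distribution on the angles `[0, 2π)`. -/
def uniformAngle : Measure ℝ :=
  (ENNReal.ofReal (2 * Real.pi))⁻¹ • volume.restrict (Set.Ico 0 (2 * Real.pi))

theorem couple_aux (μ l : Measure ℝ) [IsFiniteMeasure μ] [IsFiniteMeasure l] (g : ℝ → ℝ)
    (hg : Measurable g) (h1 : l ≤ μ) (h2 : l.map g ≤ μ) :
    ∃ ρ : Measure (ℝ × ℝ), ρ.map Prod.fst = μ ∧ ρ.map Prod.snd = μ ∧
      l.map (fun x => (x, g x)) ≤ ρ := by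
  have hpm : Measurable (fun x : ℝ => (x, g x)) := measurable_id.prodMk hg
  have ea : (μ - l) + l = μ := Measure.sub_add_cancel_of_le h1
  have eb : (μ - l.map g) + l.map g = μ := Measure.sub_add_cancel_of_le h2
  set a := μ - l with ha
  set b := μ - l.map g with hb
  have hab : a Set.univ = b Set.univ := by
    have e1 := congrArg (fun m : Measure ℝ => m Set.univ) ea
    have e2 := congrArg (fun m : Measure ℝ => m Set.univ) eb
    simp only [Measure.add_apply, Measure.map_apply hg MeasurableSet.univ, Set.preimage_univ]
      at e1 e2
    exact (ENNReal.add_left_inj (measure_ne_top l _)).1 (e1.trans e2.symm)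
  have hfa : a Set.univ ≠ ⊤ := measure_ne_top a _
  refine ⟨l.map (fun x => (x, g x)) + (a Set.univ)⁻¹ • a.prod b, ?_, ?_, ?_⟩
  · rw [Measure.map_add _ _ measurable_fst, Measure.map_map measurable_fst hpm, Measure.map_smul,
      Measure.map_fst_prod]
    have : (Prod.fst ∘ fun x : ℝ => (x, g x)) = id := rfl
    rw [this, Measure.map_id, ← hab, smul_smul]
    by_cases h0 : a Set.univ = 0
    · have : a = 0 := Measure.measure_univ_eq_zero.1 h0
      rw [this] at ea ⊢
      simpa using ea
    · rw [ENNReal.inv_mul_cancel h0 hfa, one_smul, add_comm]; exact ea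
  · rw [Measure.map_add _ _ measurable_snd, Measure.map_map measurable_snd hpm, Measure.map_smul,
      Measure.map_snd_prod]
    have : (Prod.snd ∘ fun x : ℝ => (x, g x)) = g := rfl
    rw [this, smul_smul]
    by_cases h0 : a Set.univ = 0
    · have : b = 0 := Measure.measure_univ_eq_zero.1 (hab ▸ h0)
      rw [this] at eb ⊢
      simpa using eb
    · rw [ENNReal.inv_mul_cancel h0 hfa, one_smul, add_comm]; exact eb
  · exact Measure.le_add_right le_rfl

theorem trig_aux (α β ε r t : ℝ) (hε : 0 < ε) (hε1 : ε < 1/6000) (hr : 0 ≤ r) (hr1 : r < 1/6000)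
    (hα : |α| ≤ 3 * (r * ε^2)) (hβ : |β - 1| ≤ r * ε^2)
    (ht1 : ε / 2 ≤ t) (ht2 : t ≤ Real.pi / 2 - ε / 2) :
    0 < Real.sin (2*t) ∧ 0 < 1 - (α + β * Real.cos (2*t))^2 ∧
    1 - 33 * r ≤ β * Real.sin (2*t) / √(1 - (α + β * Real.cos (2*t))^2) := by
  have hpi := Real.pi_gt_three
  have hs : ε / 2 ≤ Real.sin (2*t) := by
    have h1 : Real.sin ε ≤ Real.sin (2*t) := by
      by_cases h : 2 * t ≤ Real.pi / 2
      · exact Real.sin_le_sin_of_le_of_le_pi_div_two (by linarith) h (by linarith)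
      · rw [← Real.sin_pi_sub (2*t)]
        exact Real.sin_le_sin_of_le_of_le_pi_div_two (by linarith) (by linarith) (by linarith)
    have h2 := Real.mul_le_sin hε.le (by linarith)
    have h3 : 1/2 ≤ 2 / Real.pi := by
      rw [div_le_div_iff₀ (by norm_num) Real.pi_pos]; linarith [Real.pi_le_four]
    nlinarith
  have hsc := Real.sin_sq_add_cos_sq (2*t)
  have hc := Real.neg_one_le_cos (2*t)
  have hc' := Real.cos_le_one (2*t)
  generalize Real.sin (2*t) = s at *
  generalize Real.cos (2*t) = x at *
  have hs0 : 0 < s := by linarith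
  have hd : |α + β * x - x| ≤ 4 * (r * ε^2) := by
    have : |(β - 1) * x| ≤ r * ε^2 := by
      rw [abs_mul]
      calc _ ≤ |β - 1| * 1 := by gcongr; exact abs_le.2 ⟨hc, hc'⟩
        _ ≤ _ := by linarith
    calc |α + β * x - x| = |α + (β - 1) * x| := by ring_nf
      _ ≤ |α| + |(β - 1) * x| := abs_add_le _ _
      _ ≤ _ := by linarith
  have hes : r * ε^2 ≤ 4 * r * s^2 := by
    have : ε^2 ≤ 4 * s^2 := by nlinarith
    nlinarith
  set y := α + β * x with hy
  have hε2 : ε^2 ≤ 1 := by nlinarith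
  have hd0 : 0 ≤ r * ε^2 := by positivity
  have hd1 : r * ε^2 ≤ r := by nlinarith
  obtain ⟨hd2, hd3⟩ := abs_le.1 hd
  have hup : 1 - y^2 ≤ s^2 * (1 + 32 * r) := by
    have h0 : x * (x - y) ≤ 4 * (r * ε^2) := by
      refine (le_abs_self _).trans ?_
      rw [abs_mul, abs_sub_comm x y]
      calc |x| * |y - x| ≤ 1 * (4 * (r * ε^2)) := by
            gcongr; exact abs_le.2 ⟨hc, hc'⟩
        _ = _ := one_mul _
    have : x^2 - y^2 ≤ 8 * (r * ε^2) := by nlinarith [sq_nonneg (x - y)]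
    nlinarith
  have hlo : 0 < 1 - y^2 := by
    have h1 : y^2 - x^2 ≤ 12 * (r * ε^2) := by nlinarith
    have h2 : 0 < s^2 := by positivity
    nlinarith
  refine ⟨hs0, hlo, ?_⟩
  have hb : 1 - r ≤ β := by linarith [(abs_le.1 hβ).1]
  have h1 : (1 - 33*r)^2 * (1 + 32*r) ≤ (1-r)^2 := by
    have a1 : (1 - 33*r) * (1 + 32*r) ≤ 1 - r := by nlinarith [mul_nonneg hr hr]
    calc (1 - 33*r)^2 * (1 + 32*r) = (1 - 33*r) * ((1 - 33*r) * (1 + 32*r)) := by ring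
      _ ≤ (1 - r) * (1 - r) := by
        apply mul_le_mul (by linarith) a1 (mul_nonneg (by linarith) (by linarith)) (by linarith)
      _ = _ := by ring
  have h2 : (1-r)^2 ≤ β^2 := pow_le_pow_left₀ (by linarith) hb 2
  have h3 : 0 < s^2 := by positivity
  have hβ0 : 0 ≤ β := by linarith
  rw [le_div_iff₀ (Real.sqrt_pos.2 hlo)]
  refine (le_abs_self _).trans (abs_le_of_sq_le_sq ?_ (mul_nonneg hβ0 hs0.le))
  rw [mul_pow, Real.sq_sqrt hlo.le, mul_pow]
  calc (1 - 33*r)^2 * (1 - y^2) ≤ (1 - 33*r)^2 * (s^2 * (1 + 32 * r)) :=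
        mul_le_mul_of_nonneg_left hup (sq_nonneg _)
    _ = ((1 - 33*r)^2 * (1 + 32*r)) * s^2 := by ring
    _ ≤ β^2 * s^2 := mul_le_mul_of_nonneg_right (h1.trans h2) h3.le

/-- coupling on the first quadrant -/
theorem quad_aux (A B C D ε r : ℝ) (hε : 0 < ε) (hε1 : ε < 1/6000) (hr : 0 ≤ r)
    (hr1 : r < 1/6000) (hD : 0 < D)
    (hAC : |A - C| ≤ r * ε^2 * D) (hBD : |B - D| ≤ r * ε^2 * D) :
    ∃ ρ : Measure (ℝ × ℝ), ρ.map Prod.fst = volume.restrict (Set.Ioo 0 (Real.pi/2)) ∧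
      ρ.map Prod.snd = volume.restrict (Set.Ioo 0 (Real.pi/2)) ∧
      ENNReal.ofReal ((1 - 33 * r) * (Real.pi / 2 - ε)) ≤
        ρ {z : ℝ × ℝ | A + B * Real.cos z.1 ^ 2 = C + D * Real.cos z.2 ^ 2} := by
  have hpi := Real.pi_gt_three
  obtain ⟨α, hα⟩ : ∃ α, α = (2 * (A - C) + (B - D)) / D := ⟨_, rfl⟩
  obtain ⟨β, hβ⟩ : ∃ β, β = B / D := ⟨_, rfl⟩
  have hα' : |α| ≤ 3 * (r * ε^2) := by
    rw [hα, abs_div, abs_of_pos hD, div_le_iff₀ hD]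
    calc _ ≤ |2 * (A - C)| + |B - D| := abs_add_le _ _
      _ ≤ _ := by rw [abs_mul, abs_of_pos (by norm_num : (0:ℝ) < 2)]; linarith
  have hβ' : |β - 1| ≤ r * ε^2 := by
    have : β - 1 = (B - D) / D := by rw [hβ]; field_simp
    rw [this, abs_div, abs_of_pos hD, div_le_iff₀ hD]; exact hBD
  have hβ0 : 0 < β := by
    have := (abs_le.1 hβ').1
    have : r * ε^2 ≤ r := by
      have : ε^2 ≤ 1 := by nlinarith
      nlinarith
    linarith
  set E := Set.Icc (ε/2) (Real.pi/2 - ε/2) with hE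
  have key := fun t (ht : t ∈ E) => trig_aux α β ε r t hε hε1 hr hr1 hα' hβ' ht.1 ht.2
  set g : ℝ → ℝ := fun t => Real.arccos (α + β * Real.cos (2*t)) / 2 with hg
  have hgm : Measurable g := by
    have : Continuous g := by fun_prop
    exact this.measurable
  have hy : ∀ t ∈ E, -1 < α + β * Real.cos (2*t) ∧ α + β * Real.cos (2*t) < 1 := by
    intro t ht
    have := (key t ht).2.1
    exact abs_lt.1 ((sq_lt_one_iff_abs_lt_one _).1 (by linarith))
  have hgE : ∀ t ∈ E, g t ∈ Set.Ioo 0 (Real.pi/2) := by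
    intro t ht
    obtain ⟨h1, h2⟩ := hy t ht
    have h3 := Real.arccos_pos.2 h2
    have h4 : Real.arccos (α + β * Real.cos (2*t)) < Real.pi := by
      refine lt_of_le_of_ne (Real.arccos_le_pi _) fun h => ?_
      rw [Real.arccos_eq_pi] at h; linarith
    constructor <;> simp only [hg] <;> linarith
  have hcosg : ∀ t ∈ E, Real.cos (2 * g t) = α + β * Real.cos (2*t) := by
    intro t ht
    obtain ⟨h1, h2⟩ := hy t ht
    simp only [hg]
    rw [mul_div_cancel₀ _ (by norm_num : (2:ℝ) ≠ 0), Real.cos_arccos h1.le h2.le]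
  have hinj : Set.InjOn g E := by
    intro s hs t ht hst
    have h1 := hcosg s hs
    rw [hst, hcosg t ht] at h1
    have h2 : Real.cos (2*t) = Real.cos (2*s) := by
      have := add_left_cancel h1
      exact mul_left_cancel₀ hβ0.ne' this
    have h3 := Real.injOn_cos ⟨by linarith [ht.1], by linarith [ht.2]⟩
      ⟨by linarith [hs.1], by linarith [hs.2]⟩ h2
    linarith
  have hder : ∀ t ∈ E, HasDerivAt g
      (β * Real.sin (2*t) / √(1 - (α + β * Real.cos (2*t))^2)) t := by
    intro t ht
    obtain ⟨h1, h2⟩ := hy t ht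
    have e1 : HasDerivAt (fun t : ℝ => 2 * t) 2 t := by
      simpa using (hasDerivAt_id t).const_mul 2
    have e2 := ((e1.cos).const_mul β).const_add α
    have e3 := ((Real.hasDerivAt_arccos h1.ne' h2.ne).comp t e2).div_const 2
    refine e3.congr_deriv ?_
    ring
  have hEm : MeasurableSet E := measurableSet_Icc
  set κ := ENNReal.ofReal (1 - 33 * r) with hκ
  have hκ1 : κ ≤ 1 := by
    rw [hκ]; exact ENNReal.ofReal_le_one.2 (by linarith)
  have hEI : E ⊆ Set.Ioo 0 (Real.pi/2) := by
    intro t ht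
    exact ⟨by linarith [ht.1], by linarith [ht.2]⟩
  have hfin : IsFiniteMeasure (κ • (volume.restrict E : Measure ℝ)) := by
    constructor
    rw [Measure.smul_apply, smul_eq_mul, Measure.restrict_apply_univ, Real.volume_Icc]
    exact ENNReal.mul_lt_top (lt_of_le_of_lt hκ1 ENNReal.one_lt_top) ENNReal.ofReal_lt_top
  have hfin2 : IsFiniteMeasure (volume.restrict (Set.Ioo 0 (Real.pi/2)) : Measure ℝ) := by
    constructor
    rw [Measure.restrict_apply_univ, Real.volume_Ioo]
    exact ENNReal.ofReal_lt_top
  obtain ⟨ρ, h1, h2, h3⟩ := couple_aux (volume.restrict (Set.Ioo 0 (Real.pi/2)))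
    (κ • volume.restrict E) g hgm (by
      refine Measure.le_iff.2 fun F hF => ?_
      rw [Measure.smul_apply, smul_eq_mul]
      calc _ ≤ 1 * (volume.restrict E) F := by gcongr
        _ ≤ _ := by rw [one_mul]; exact Measure.restrict_mono hEI le_rfl F) (by
      refine Measure.le_iff.2 fun F hF => ?_
      rw [Measure.map_apply hgm hF, Measure.smul_apply, smul_eq_mul,
        Measure.restrict_apply (hgm hF), Measure.restrict_apply hF]
      have hm : MeasurableSet (g ⁻¹' F ∩ E) := (hgm hF).inter hEm
      have e := lintegral_image_eq_lintegral_abs_deriv_mul hm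
        (fun x hx => (hder x hx.2).hasDerivWithinAt) (hinj.mono Set.inter_subset_right)
        (fun _ => 1)
      rw [setLIntegral_one] at e
      calc κ * volume (g ⁻¹' F ∩ E) = ∫⁻ x in g ⁻¹' F ∩ E, κ := (setLIntegral_const _ _).symm
        _ ≤ volume (g '' (g ⁻¹' F ∩ E)) := by
          rw [e]
          refine setLIntegral_mono' hm fun x hx => ?_
          rw [mul_one]
          exact ENNReal.ofReal_le_ofReal ((key x hx.2).2.2.trans (le_abs_self _))
        _ ≤ _ := by
          apply measure_mono
          rintro _ ⟨x, hx, rfl⟩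
          exact ⟨hx.1, hgE x hx.2⟩)
  refine ⟨ρ, h1, h2, ?_⟩
  refine le_trans ?_ (h3 _)
  have hSm : MeasurableSet {z : ℝ × ℝ | A + B * Real.cos z.1 ^ 2 = C + D * Real.cos z.2 ^ 2} :=
    measurableSet_eq_fun (by fun_prop) (by fun_prop)
  have hpm : Measurable (fun x : ℝ => (x, g x)) := measurable_id.prodMk hgm
  rw [Measure.map_apply hpm hSm, Measure.smul_apply, smul_eq_mul]
  rw [Measure.restrict_apply (hpm hSm)]
  rw [Set.inter_eq_right.2]
  · rw [Real.volume_Icc, hκ, ← ENNReal.ofReal_mul (by linarith)]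
    apply ENNReal.ofReal_le_ofReal
    apply le_of_eq; ring
  · intro t ht
    have e1 := hcosg t ht
    simp only [Set.mem_preimage, Set.mem_setOf_eq]
    rw [Real.cos_two_mul, Real.cos_two_mul] at e1
    have e2 : D * (2 * Real.cos (g t)^2 - 1) = (2 * (A - C) + (B - D)) + B * (2 * Real.cos t^2 - 1) := by
      rw [e1, hα, hβ]; field_simp
    linarith

theorem map_restrict_aux (σ : ℝ → ℝ) (hσ : MeasurePreserving σ volume volume) (a b : ℝ)
    (h : ∀ x, σ x ∈ Set.Ioo a b ↔ x ∈ Set.Ioo 0 (Real.pi / 2)) :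
    (volume.restrict (Set.Ioo 0 (Real.pi / 2))).map σ = volume.restrict (Set.Ico a b) := by
  have e : σ ⁻¹' Set.Ioo a b = Set.Ioo 0 (Real.pi / 2) := Set.ext h
  rw [← e, (hσ.restrict_preimage measurableSet_Ioo).map_eq]
  exact Measure.restrict_congr_set Ioo_ae_eq_Ico

theorem fold_aux (ρ : Measure (ℝ × ℝ))
    (h1 : ρ.map Prod.fst = volume.restrict (Set.Ioo 0 (Real.pi/2)))
    (h2 : ρ.map Prod.snd = volume.restrict (Set.Ioo 0 (Real.pi/2))) (A B C D m : ℝ)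
    (hm : 0 ≤ m)
    (h3 : ENNReal.ofReal m ≤ ρ {z | A + B * Real.cos z.1 ^ 2 = C + D * Real.cos z.2 ^ 2}) :
    ∃ π : Measure (ℝ × ℝ),
        Measure.map Prod.fst π = uniformAngle ∧
        Measure.map Prod.snd π = uniformAngle ∧
        π {z : ℝ × ℝ |
          ¬(0 ≤ Real.cos z.1 * Real.cos z.2 ∧ 0 ≤ Real.sin z.1 * Real.sin z.2)} = 0 ∧
        (π {z : ℝ × ℝ | A + B * Real.cos z.1 ^ 2 = C + D * Real.cos z.2 ^ 2}).toReal ≥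
          (2 * Real.pi)⁻¹ * (4 * m) := by
  have hpi := Real.pi_pos
  let σ : Fin 4 → ℝ → ℝ := ![fun x => x, fun x => Real.pi - x, fun x => Real.pi + x,
    fun x => 2 * Real.pi - x]
  have hp : ∀ k, MeasurePreserving (σ k) volume volume := by
    intro k
    fin_cases k
    · exact MeasurePreserving.id _
    · exact Measure.measurePreserving_sub_left volume Real.pi
    · exact measurePreserving_add_left volume Real.pi
    · exact Measure.measurePreserving_sub_left volume (2 * Real.pi)
  have hcc : ∀ k x y, Real.cos (σ k x) * Real.cos (σ k y) = Real.cos x * Real.cos y := by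
    intro k x y
    fin_cases k
    · rfl
    · simp [σ, Real.cos_pi_sub]
    · simp [σ, add_comm Real.pi, Real.cos_add_pi]
    · simp [σ, Real.cos_two_pi_sub]
  have hss : ∀ k x y, Real.sin (σ k x) * Real.sin (σ k y) = Real.sin x * Real.sin y := by
    intro k x y
    fin_cases k
    · rfl
    · simp [σ, Real.sin_pi_sub]
    · simp [σ, add_comm Real.pi, Real.sin_add_pi]
    · simp [σ, Real.sin_two_pi_sub]
  have hsm : ∀ k, Measurable (σ k) := fun k => (hp k).measurable
  have hsum : ∑ k, (volume.restrict (Set.Ioo 0 (Real.pi / 2))).map (σ k)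
      = volume.restrict (Set.Ico 0 (2 * Real.pi)) := by
    rw [Fin.sum_univ_four, map_restrict_aux (σ 0) (hp 0) 0 (Real.pi/2),
      map_restrict_aux (σ 1) (hp 1) (Real.pi/2) Real.pi,
      map_restrict_aux (σ 2) (hp 2) Real.pi (3 * Real.pi/2),
      map_restrict_aux (σ 3) (hp 3) (3 * Real.pi/2) (2 * Real.pi)]
    · have hd : ∀ a b c : ℝ, Disjoint (Set.Ico a b) (Set.Ico b c) := by
        intro a b c
        rw [Set.disjoint_left]
        intro x hx hx'
        exact absurd hx.2 (not_lt.2 hx'.1)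
      rw [← Measure.restrict_union (hd _ _ _) measurableSet_Ico,
        Set.Ico_union_Ico_eq_Ico (by linarith) (by linarith),
        ← Measure.restrict_union (hd _ _ _) measurableSet_Ico,
        Set.Ico_union_Ico_eq_Ico (by linarith) (by linarith),
        ← Measure.restrict_union (hd _ _ _) measurableSet_Ico,
        Set.Ico_union_Ico_eq_Ico (by linarith) (by linarith)]
    all_goals
      intro x
      simp only [σ, Set.mem_Ioo]
      constructor <;> intro h <;> constructor <;> simp at h ⊢ <;> linarith [h.1, h.2]
  have hP : ∀ k, Measurable (Prod.map (σ k) (σ k)) := fun k => (hsm k).prodMap (hsm k)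
  set c := (ENNReal.ofReal (2 * Real.pi))⁻¹ with hc
  have hcr : c = ENNReal.ofReal (2 * Real.pi)⁻¹ := by
    rw [hc, ENNReal.ofReal_inv_of_pos (by positivity)]
  have hfst : Measure.map Prod.fst (c • ∑ k, ρ.map (Prod.map (σ k) (σ k))) = uniformAngle := by
    rw [Measure.map_smul, uniformAngle, ← hsum, ← h1]
    congr 1
    simp only [Fin.sum_univ_four]
    rw [Measure.map_add _ _ measurable_fst, Measure.map_add _ _ measurable_fst,
      Measure.map_add _ _ measurable_fst]
    simp only [Measure.map_map measurable_fst (hP _), Measure.map_map (hsm _) measurable_fst]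
    rfl
  have hsnd : Measure.map Prod.snd (c • ∑ k, ρ.map (Prod.map (σ k) (σ k))) = uniformAngle := by
    rw [Measure.map_smul, uniformAngle, ← hsum, ← h2]
    congr 1
    simp only [Fin.sum_univ_four]
    rw [Measure.map_add _ _ measurable_snd, Measure.map_add _ _ measurable_snd,
      Measure.map_add _ _ measurable_snd]
    simp only [Measure.map_map measurable_snd (hP _), Measure.map_map (hsm _) measurable_snd]
    rfl
  have hSm : MeasurableSet {z : ℝ × ℝ | A + B * Real.cos z.1 ^ 2 = C + D * Real.cos z.2 ^ 2} :=
    measurableSet_eq_fun (by fun_prop) (by fun_prop)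
  have hQm : MeasurableSet {z : ℝ × ℝ |
      ¬(0 ≤ Real.cos z.1 * Real.cos z.2 ∧ 0 ≤ Real.sin z.1 * Real.sin z.2)} := by
    apply MeasurableSet.compl
    have m1 : MeasurableSet {z : ℝ × ℝ | 0 ≤ Real.cos z.1 * Real.cos z.2} :=
      measurableSet_le (by fun_prop) (by fun_prop)
    have m2 : MeasurableSet {z : ℝ × ℝ | 0 ≤ Real.sin z.1 * Real.sin z.2} :=
      measurableSet_le (by fun_prop) (by fun_prop)
    exact m1.inter m2
  have hfin : ∀ S, (c • ∑ k, ρ.map (Prod.map (σ k) (σ k))) S ≠ ⊤ := by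
    intro S
    refine ne_top_of_le_ne_top ?_ (measure_mono (Set.subset_univ S))
    have : (Measure.map Prod.fst (c • ∑ k, ρ.map (Prod.map (σ k) (σ k)))) Set.univ ≠ ⊤ := by
      rw [hfst, uniformAngle, Measure.smul_apply, Measure.restrict_apply_univ, Real.volume_Ico,
        smul_eq_mul, ← hc, hcr]
      exact ENNReal.mul_ne_top ENNReal.ofReal_ne_top ENNReal.ofReal_ne_top
    rwa [Measure.map_apply measurable_fst MeasurableSet.univ, Set.preimage_univ] at this
  refine ⟨c • ∑ k, ρ.map (Prod.map (σ k) (σ k)), hfst, hsnd, ?_, ?_⟩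
  · rw [Measure.smul_apply, Measure.finsetSum_apply]
    rw [Finset.sum_eq_zero, smul_zero]
    intro k _
    rw [Measure.map_apply (hP k) hQm]
    have a1 : ∀ᵐ z ∂ρ, z.1 ∈ Set.Ioo 0 (Real.pi/2) := by
      have : ∀ᵐ x ∂(ρ.map Prod.fst), x ∈ Set.Ioo 0 (Real.pi/2) := by
        rw [h1]; exact ae_restrict_mem measurableSet_Ioo
      exact ae_of_ae_map measurable_fst.aemeasurable this
    have a2 : ∀ᵐ z ∂ρ, z.2 ∈ Set.Ioo 0 (Real.pi/2) := by
      have : ∀ᵐ x ∂(ρ.map Prod.snd), x ∈ Set.Ioo 0 (Real.pi/2) := by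
        rw [h2]; exact ae_restrict_mem measurableSet_Ioo
      exact ae_of_ae_map measurable_snd.aemeasurable this
    have a3 : ∀ᵐ z ∂ρ, 0 ≤ Real.cos (σ k z.1) * Real.cos (σ k z.2) ∧
        0 ≤ Real.sin (σ k z.1) * Real.sin (σ k z.2) := by
      filter_upwards [a1, a2] with z hz1 hz2
      rw [hcc, hss]
      exact ⟨mul_nonneg (Real.cos_nonneg_of_mem_Icc ⟨by linarith [hz1.1], hz1.2.le⟩)
        (Real.cos_nonneg_of_mem_Icc ⟨by linarith [hz2.1], hz2.2.le⟩),
        mul_nonneg (Real.sin_nonneg_of_nonneg_of_le_pi hz1.1.le (by linarith [hz1.2]))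
        (Real.sin_nonneg_of_nonneg_of_le_pi hz2.1.le (by linarith [hz2.2]))⟩
    exact ae_iff.1 a3
  · have hle : ENNReal.ofReal ((2 * Real.pi)⁻¹ * (4 * m)) ≤
        (c • ∑ k, ρ.map (Prod.map (σ k) (σ k)))
          {z : ℝ × ℝ | A + B * Real.cos z.1 ^ 2 = C + D * Real.cos z.2 ^ 2} := by
      rw [Measure.smul_apply, Measure.finsetSum_apply, smul_eq_mul,
        ENNReal.ofReal_mul (by positivity), ← hcr]
      gcongr
      have : ∀ k ∈ Finset.univ, ENNReal.ofReal m ≤ (ρ.map (Prod.map (σ k) (σ k)))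
          {z : ℝ × ℝ | A + B * Real.cos z.1 ^ 2 = C + D * Real.cos z.2 ^ 2} := by
        intro k _
        rw [Measure.map_apply (hP k) hSm]
        refine h3.trans (le_of_eq ?_)
        congr 1
        ext z
        simp only [Set.mem_preimage, Set.mem_setOf_eq, Prod.map_fst, Prod.map_snd]
        rw [pow_two (Real.cos (σ k z.1)), pow_two (Real.cos (σ k z.2)), hcc, hcc, ← pow_two,
          ← pow_two]
      refine le_trans (le_of_eq ?_) (Finset.card_nsmul_le_sum _ _ _ this)
      rw [ENNReal.ofReal_mul (by norm_num)]
      simp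
    have := ENNReal.toReal_mono (hfin _) hle
    rwa [ENNReal.toReal_ofReal (by positivity)] at this

/-- Coupling success lemma (Lemma 4.3): fix `1 < p < q' < q/2` and set
`c = min(q'/2, q − 2q')`. For all large `n` and all `0 ≤ A, B, C, D ≤ 1` with
`|A − C|, |B − D| ≤ n^{−q}` and `B, D ≥ n^{−p}`, there is a coupling `π` of two uniform
angles on `[0, 2π)` under which almost surely `cos θ · cos θ' ≥ 0` and
`sin θ · sin θ' ≥ 0`, and `A + B cos²θ = C + D cos²θ'` with probability at least
`1 − 6·10³·n^{−c}`. -/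
theorem coupling_success (p q q' : ℝ) (hp : 1 < p) (hpq' : p < q') (hq'q : q' < q / 2) :
    ∃ N0 : ℕ, ∀ n : ℕ, n > N0 →
      ∀ A B C D : ℝ, 0 ≤ A → A ≤ 1 → 0 ≤ B → B ≤ 1 → 0 ≤ C → C ≤ 1 → 0 ≤ D → D ≤ 1 →
      |A - C| ≤ (n : ℝ) ^ (-q) → |B - D| ≤ (n : ℝ) ^ (-q) →
      (n : ℝ) ^ (-p) ≤ B → (n : ℝ) ^ (-p) ≤ D →
      ∃ π : Measure (ℝ × ℝ),
        Measure.map Prod.fst π = uniformAngle ∧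
        Measure.map Prod.snd π = uniformAngle ∧
        π {z : ℝ × ℝ |
          ¬(0 ≤ Real.cos z.1 * Real.cos z.2 ∧ 0 ≤ Real.sin z.1 * Real.sin z.2)} = 0 ∧
        (π {z : ℝ × ℝ | A + B * Real.cos z.1 ^ 2 = C + D * Real.cos z.2 ^ 2}).toReal ≥
          1 - 6 * 10 ^ 3 * (n : ℝ) ^ (-min (q' / 2) (q - 2 * q')) := by
  refine ⟨1, fun n hn A B C D hA hA1 hB hB1 hC hC1 hD hD1 hAC hBD hnB hnD => ?_⟩
  have hX : (1:ℝ) < n := by exact_mod_cast hn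
  have hX0 : (0:ℝ) < n := by linarith
  set M := (n : ℝ) ^ (-min (q' / 2) (q - 2 * q')) with hM
  by_cases hbig : 1 / 6000 ≤ M
  · obtain ⟨ρ, h1, h2, -⟩ := couple_aux (volume.restrict (Set.Ioo 0 (Real.pi/2))) 0 id
      measurable_id (Measure.zero_le _) (by rw [Measure.map_zero]; exact Measure.zero_le _)
    obtain ⟨π, g1, g2, g3, g4⟩ := fold_aux ρ h1 h2 A B C D 0 le_rfl (by simp)
    refine ⟨π, g1, g2, g3, le_trans ?_ g4⟩
    linarith
  · push Not at hbig
    obtain ⟨ε, hε⟩ : ∃ ε, ε = (n : ℝ) ^ (-(q'/2)) := ⟨_, rfl⟩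
    obtain ⟨r, hr⟩ : ∃ r, r = (n : ℝ) ^ (-(q - 2 * q')) := ⟨_, rfl⟩
    have hε0 : 0 < ε := hε ▸ Real.rpow_pos_of_pos hX0 _
    have hr0 : 0 < r := hr ▸ Real.rpow_pos_of_pos hX0 _
    have hεM : ε ≤ M := by
      rw [hε, hM]
      exact Real.rpow_le_rpow_of_exponent_le hX.le (neg_le_neg (min_le_left _ _))
    have hrM : r ≤ M := by
      rw [hr, hM]
      exact Real.rpow_le_rpow_of_exponent_le hX.le (neg_le_neg (min_le_right _ _))
    have hD0 : 0 < D := lt_of_lt_of_le (Real.rpow_pos_of_pos hX0 _) hnD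
    have hq : (n : ℝ) ^ (-q) ≤ r * ε^2 * D := by
      have e : r * ε^2 = (n : ℝ) ^ (-(q - q')) := by
        rw [hr, hε, pow_two, ← Real.rpow_add hX0, ← Real.rpow_add hX0]
        congr 1; ring
      calc (n : ℝ) ^ (-q) ≤ (n : ℝ) ^ (-(q - q') + -p) :=
            Real.rpow_le_rpow_of_exponent_le hX.le (by linarith)
        _ = r * ε^2 * (n : ℝ) ^ (-p) := by rw [Real.rpow_add hX0, e]
        _ ≤ _ := by gcongr
    obtain ⟨ρ, h1, h2, h3⟩ := quad_aux A B C D ε r hε0 (by linarith) hr0.le (by linarith) hD0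
      (hAC.trans hq) (hBD.trans hq)
    have hpi := Real.pi_gt_three
    obtain ⟨π, g1, g2, g3, g4⟩ := fold_aux ρ h1 h2 A B C D _
      (mul_nonneg (by linarith) (by linarith)) h3
    refine ⟨π, g1, g2, g3, le_trans ?_ g4⟩
    rw [inv_mul_eq_div, le_div_iff₀ (by positivity)]
    have k1 : 1 - 6 * 10^3 * M ≤ 1 - 33 * r - ε := by linarith
    have k2 : (1 - 33 * r - ε) * (2 * Real.pi) ≤
        4 * ((1 - 33 * r) * (Real.pi / 2 - ε)) := by
      nlinarith [mul_nonneg hr0.le hε0.le]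
    refine le_trans ?_ k2
    gcongr

end
end

section
/- Total variation bound between two shifted arcsine laws (core estimate in the proof of Lemma 4.3): Fix positive reals 1 < p < q' < q/2. There exists N0(p, q, q') such that for all n > N0(p, q, q') the following holds. Let A, B, C, D be reals with 0 ≤ A, B, C, D ≤ 1, |A − C| ≤ n^{−q}, |B − D| ≤ n^{−q}, and B, D ≥ n^{−p}. Let θ be uniform on [0, 2π), and let L(A + B·cos(θ)^2) and L(C + D·cos(θ)^2) denote the laws of A + B·cos(θ)^2 and C + D·cos(θ)^2 respectively. Then ‖ L(A + B·cos(θ)^2) − L(C + D·cos(θ)^2) ‖_TV ≤ 5·10^3·n^{2q'−q} + (2/π)·n^{−q'/2}. -/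
open MeasureTheory
open scoped ENNReal

noncomputable section

/-- Total variation distance between two measures: `sup_A (μ(A) - ν(A))`. -/
def tvDist {α : Type*} [MeasurableSpace α] (μ ν : Measure α) : ℝ :=
  ⨆ A : {s : Set α // MeasurableSet s}, ((μ A).toReal - (ν A).toReal)

lemma vol_four (E : Set ℝ) (hE : MeasurableSet E) (hneg : ∀ θ, Real.pi - θ ∈ E ↔ θ ∈ E)
    (hper : ∀ θ, θ + Real.pi ∈ E ↔ θ ∈ E) :
    volume (E ∩ Set.Ico 0 (2 * Real.pi)) = 4 * volume (E ∩ Set.Ioo 0 (Real.pi / 2)) := by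
  have hpi := Real.pi_pos
  have h1 : volume (E ∩ Set.Ico 0 (2 * Real.pi)) =
      volume (E ∩ Set.Ico 0 Real.pi) + volume (E ∩ Set.Ico Real.pi (2 * Real.pi)) := by
    rw [← measure_union _ (hE.inter measurableSet_Ico), ← Set.inter_union_distrib_left,
      Set.Ico_union_Ico_eq_Ico (by linarith) (by linarith)]
    refine Set.disjoint_left.2 ?_
    rintro x ⟨_, hx⟩ ⟨_, hx'⟩
    exact absurd hx.2 (not_lt.2 hx'.1)
  have h2 : volume (E ∩ Set.Ico Real.pi (2 * Real.pi)) = volume (E ∩ Set.Ico 0 Real.pi) := by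
    rw [← measure_preimage_add_right volume Real.pi (E ∩ Set.Ico Real.pi (2 * Real.pi))]
    congr 1
    ext θ
    simp only [Set.mem_preimage, Set.mem_inter_iff, hper, Set.mem_Ico]
    refine and_congr_right fun _ => ⟨fun h => ⟨by linarith [h.1], by linarith [h.2]⟩,
      fun h => ⟨by linarith [h.1], by linarith [h.2]⟩⟩
  have h3 : volume (E ∩ Set.Ico 0 Real.pi) =
      volume (E ∩ Set.Ico 0 (Real.pi / 2)) + volume (E ∩ Set.Ico (Real.pi / 2) Real.pi) := by
    rw [← measure_union _ (hE.inter measurableSet_Ico), ← Set.inter_union_distrib_left,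
      Set.Ico_union_Ico_eq_Ico (by linarith) (by linarith)]
    refine Set.disjoint_left.2 ?_
    rintro x ⟨_, hx⟩ ⟨_, hx'⟩
    exact absurd hx.2 (not_lt.2 hx'.1)
  have h4 : volume (E ∩ Set.Ico (Real.pi / 2) Real.pi) = volume (E ∩ Set.Ioc 0 (Real.pi / 2)) := by
    rw [← (Measure.measurePreserving_sub_left volume Real.pi).measure_preimage
      (hE.inter measurableSet_Ico).nullMeasurableSet]
    congr 1
    ext θ
    simp only [Set.mem_preimage, Set.mem_inter_iff, hneg, Set.mem_Ico, Set.mem_Ioc]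
    refine and_congr_right fun _ => ⟨fun h => ⟨by linarith [h.2], by linarith [h.1]⟩,
      fun h => ⟨by linarith [h.2], by linarith [h.1]⟩⟩
  have h5 : volume (E ∩ Set.Ico 0 (Real.pi / 2)) = volume (E ∩ Set.Ioo 0 (Real.pi / 2)) :=
    measure_congr ((ae_eq_refl E).inter Ioo_ae_eq_Ico.symm)
  have h6 : volume (E ∩ Set.Ioc 0 (Real.pi / 2)) = volume (E ∩ Set.Ioo 0 (Real.pi / 2)) :=
    measure_congr ((ae_eq_refl E).inter Ioo_ae_eq_Ioc.symm)
  rw [h1, h2, h3, h4, h5, h6]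
  ring

lemma meas_X (A B : ℝ) : Measurable (fun θ : ℝ => A + B * Real.cos θ ^ 2) := by fun_prop

lemma law_eq (A B : ℝ) (S : Set ℝ) (hS : MeasurableSet S) :
    ((Measure.map (fun θ : ℝ => A + B * Real.cos θ ^ 2) uniformAngle) S).toReal =
      (2 / Real.pi) * (volume ((fun θ : ℝ => A + B * Real.cos θ ^ 2) ⁻¹' S ∩
        Set.Ioo 0 (Real.pi / 2))).toReal := by
  have hpi := Real.pi_pos
  rw [Measure.map_apply (meas_X A B) hS, uniformAngle, Measure.smul_apply,
    Measure.restrict_apply (meas_X A B hS), vol_four _ (meas_X A B hS)]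
  · rw [smul_eq_mul, ENNReal.toReal_mul, ENNReal.toReal_mul, ENNReal.toReal_inv,
      ENNReal.toReal_ofReal (by positivity)]
    have : (4 : ℝ≥0∞).toReal = 4 := by simp
    rw [this]
    field_simp
    norm_num
  · intro θ
    simp [Real.cos_pi_sub]
  · intro θ
    simp [Real.cos_add_pi]

/-- density (up to normalisation) -/
def dens (A B x : ℝ) : ℝ := 1 / (2 * √((x - A) * (A + B - x)))

lemma vol_eq (A B : ℝ) (hB : 0 < B) (S : Set ℝ) (hS : MeasurableSet S) :
    volume ((fun θ : ℝ => A + B * Real.cos θ ^ 2) ⁻¹' S ∩ Set.Ioo 0 (Real.pi / 2)) =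
      ∫⁻ x in S ∩ Set.Ioo A (A + B), ENNReal.ofReal (dens A B x) := by
  have hpi := Real.pi_pos
  set X := (fun θ : ℝ => A + B * Real.cos θ ^ 2) with hX
  set E := X ⁻¹' S ∩ Set.Ioo 0 (Real.pi / 2) with hE
  have hcos : ∀ θ ∈ Set.Ioo (0:ℝ) (Real.pi / 2), 0 < Real.cos θ := fun θ hθ =>
    Real.cos_pos_of_mem_Ioo ⟨by linarith [hθ.1], hθ.2⟩
  have hsin : ∀ θ ∈ Set.Ioo (0:ℝ) (Real.pi / 2), 0 < Real.sin θ := fun θ hθ =>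
    Real.sin_pos_of_pos_of_lt_pi hθ.1 (by linarith [hθ.2])
  have himg : X '' E = S ∩ Set.Ioo A (A + B) := by
    ext x
    constructor
    · rintro ⟨θ, ⟨hθS, hθ⟩, rfl⟩
      refine ⟨hθS, ?_, ?_⟩
      · have := hcos θ hθ
        simp only [hX]
        have : 0 < B * Real.cos θ ^ 2 := by positivity
        linarith
      · have h1 := hsin θ hθ
        have h2 := Real.sin_sq_add_cos_sq θ
        simp only [hX]
        have : 0 < B * Real.sin θ ^ 2 := by positivity
        nlinarith
    · rintro ⟨hxS, hx1, hx2⟩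
      have h0 : 0 < (x - A) / B := div_pos (by linarith) hB
      have h1 : (x - A) / B < 1 := by rw [div_lt_one hB]; linarith
      have hs0 : 0 < √((x - A) / B) := Real.sqrt_pos.2 h0
      have hs1 : √((x - A) / B) < 1 := by
        rw [Real.sqrt_lt' one_pos]; simpa using h1
      have hval : X (Real.arccos (√((x - A) / B))) = x := by
        simp only [hX]
        rw [Real.cos_arccos (by linarith) hs1.le, Real.sq_sqrt h0.le]
        field_simp
        ring
      refine ⟨Real.arccos (√((x - A) / B)), ⟨?_, ?_, ?_⟩, hval⟩
      · rw [Set.mem_preimage, hval]; exact hxS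
      · exact Real.arccos_pos.2 hs1
      · exact Real.arccos_lt_pi_div_two.2 hs0
  have hinj : Set.InjOn X E := by
    rintro a ⟨_, ha⟩ b ⟨_, hb⟩ hab
    simp only [hX] at hab
    have h1 : Real.cos a ^ 2 = Real.cos b ^ 2 := by
      have := add_left_cancel hab
      exact mul_left_cancel₀ hB.ne' this
    have h2 : Real.cos a = Real.cos b :=
      (sq_eq_sq₀ (hcos a ha).le (hcos b hb).le).1 h1
    exact Real.injOn_cos ⟨ha.1.le, by linarith [ha.2]⟩ ⟨hb.1.le, by linarith [hb.2]⟩ h2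
  have hmE : MeasurableSet E := (meas_X A B hS).inter measurableSet_Ioo
  have hder : ∀ θ ∈ E, HasDerivWithinAt X (B * (2 * Real.cos θ * (-Real.sin θ))) E θ := by
    intro θ _
    have := ((((Real.hasDerivAt_cos θ).pow 2).const_mul B).const_add A).hasDerivWithinAt (s := E)
    refine (this.congr_deriv ?_)
    simp
  rw [← himg, lintegral_image_eq_lintegral_abs_deriv_mul hmE hder hinj, ← setLIntegral_one]
  refine setLIntegral_congr_fun hmE ?_
  rintro θ ⟨_, hθ⟩
  have hc := hcos θ hθ
  have hs := hsin θ hθ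
  have hpos : 0 < B * Real.cos θ * Real.sin θ := by positivity
  have hd : dens A B (X θ) = 1 / (2 * (B * Real.cos θ * Real.sin θ)) := by
    simp only [dens, hX]
    have : (A + B * Real.cos θ ^ 2 - A) * (A + B - (A + B * Real.cos θ ^ 2)) =
        (B * Real.cos θ * Real.sin θ) ^ 2 := by
      have := Real.sin_sq θ
      rw [mul_pow, this]; ring
    rw [this, Real.sqrt_sq hpos.le]
  have ha : |B * (2 * Real.cos θ * (-Real.sin θ))| = 2 * (B * Real.cos θ * Real.sin θ) := by
    rw [show B * (2 * Real.cos θ * (-Real.sin θ)) = -(2 * (B * Real.cos θ * Real.sin θ)) by ring,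
      abs_neg, abs_of_pos (by positivity)]
  simp only
  rw [hd, ha, ← ENNReal.ofReal_mul (by positivity), mul_one_div_cancel (by positivity),
    ENNReal.ofReal_one]

lemma edge1 (A B δ : ℝ) (hB : 0 < B) :
    volume ((fun θ : ℝ => A + B * Real.cos θ ^ 2) ⁻¹' (Set.Iio (A + δ)) ∩ Set.Ioo 0 (Real.pi / 2))
      ≤ ENNReal.ofReal (Real.pi / 2 * √(δ / B)) := by
  have hpi := Real.pi_pos
  calc _ ≤ volume (Set.Ioo (Real.pi / 2 - Real.pi / 2 * √(δ / B)) (Real.pi / 2)) := by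
        refine measure_mono ?_
        rintro θ ⟨h1, h2, h3⟩
        refine ⟨?_, h3⟩
        simp only [Set.mem_preimage, Set.mem_Iio] at h1
        have h4 : Real.cos θ ^ 2 < δ / B := by
          rw [lt_div_iff₀ hB]; linarith
        have h5 : Real.cos θ < √(δ / B) := Real.lt_sqrt_of_sq_lt h4
        have h6 := Real.mul_le_sin (x := Real.pi / 2 - θ) (by linarith) (by linarith)
        rw [Real.sin_pi_div_two_sub] at h6
        have h7 : 2 / Real.pi * (Real.pi / 2 - θ) < √(δ / B) := by linarith
        have h8 : Real.pi / 2 * (2 / Real.pi * (Real.pi / 2 - θ)) < Real.pi / 2 * √(δ / B) := by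
          gcongr
        have h9 : Real.pi / 2 * (2 / Real.pi * (Real.pi / 2 - θ)) = Real.pi / 2 - θ := by
          field_simp
        linarith
    _ = _ := by rw [Real.volume_Ioo]; congr 1; ring

lemma edge2 (A B δ : ℝ) (hB : 0 < B) :
    volume ((fun θ : ℝ => A + B * Real.cos θ ^ 2) ⁻¹' (Set.Ioi (A + B - δ)) ∩
      Set.Ioo 0 (Real.pi / 2)) ≤ ENNReal.ofReal (Real.pi / 2 * √(δ / B)) := by
  have hpi := Real.pi_pos
  calc _ ≤ volume (Set.Ioo 0 (Real.pi / 2 * √(δ / B))) := by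
        refine measure_mono ?_
        rintro θ ⟨h1, h2, h3⟩
        refine ⟨h2, ?_⟩
        simp only [Set.mem_preimage, Set.mem_Ioi] at h1
        have h4 : Real.sin θ ^ 2 < δ / B := by
          rw [lt_div_iff₀ hB, Real.sin_sq]; linarith
        have h5 : Real.sin θ < √(δ / B) := Real.lt_sqrt_of_sq_lt h4
        have h6 := Real.mul_le_sin (x := θ) h2.le h3.le
        have h7 : 2 / Real.pi * θ < √(δ / B) := by linarith
        have h8 : Real.pi / 2 * (2 / Real.pi * θ) < Real.pi / 2 * √(δ / B) := by
          gcongr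
        have h9 : Real.pi / 2 * (2 / Real.pi * θ) = θ := by
          field_simp
        linarith
    _ = _ := by rw [Real.volume_Ioo]; congr 1; ring

lemma dens_le (A B C D ε δ x : ℝ) (hδ : 2 * ε < δ) (hε : 0 ≤ ε)
    (hAC : |A - C| ≤ ε) (hBD : |B - D| ≤ ε)
    (h1 : A + δ ≤ x) (h2 : x ≤ A + B - δ) :
    dens A B x ≤ (1 + 2 * ε / δ) * dens C D x ∧ x ∈ Set.Ioo C (C + D) := by
  have hδ0 : 0 < δ := by linarith
  obtain ⟨a1, a2⟩ := abs_le.1 hAC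
  obtain ⟨b1, b2⟩ := abs_le.1 hBD
  have hs : 0 < x - A := by linarith
  have ht : 0 < A + B - x := by linarith
  have hs' : 0 < x - C := by linarith
  have ht' : 0 < C + D - x := by linarith
  refine ⟨?_, by linarith, by linarith⟩
  set η := 2 * ε / δ with hη
  have hη0 : 0 ≤ η := by positivity
  have hηδ : η * δ = 2 * ε := by rw [hη]; field_simp
  have e1 : x - C ≤ (1 + η) * (x - A) := by nlinarith
  have e2 : C + D - x ≤ (1 + η) * (A + B - x) := by nlinarith
  have e3 : (x - C) * (C + D - x) ≤ (1 + η) ^ 2 * ((x - A) * (A + B - x)) := by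
    calc _ ≤ ((1 + η) * (x - A)) * ((1 + η) * (A + B - x)) := by gcongr
      _ = _ := by ring
  have e4 : √((x - C) * (C + D - x)) ≤ (1 + η) * √((x - A) * (A + B - x)) := by
    calc _ ≤ √((1 + η) ^ 2 * ((x - A) * (A + B - x))) := Real.sqrt_le_sqrt e3
      _ = _ := by rw [Real.sqrt_mul (by positivity), Real.sqrt_sq (by positivity)]
  have p1 : 0 < √((x - C) * (C + D - x)) := Real.sqrt_pos.2 (by positivity)
  have p2 : 0 < √((x - A) * (A + B - x)) := Real.sqrt_pos.2 (by positivity)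
  rw [dens, dens, mul_one_div, div_le_div_iff₀ (by positivity) (by positivity)]
  linarith

lemma vol_le (A B C D ε δ : ℝ) (hδ : 2 * ε < δ) (hε : 0 ≤ ε) (hB : 0 < B) (hD : 0 < D)
    (hAC : |A - C| ≤ ε) (hBD : |B - D| ≤ ε) (S : Set ℝ) (hS : MeasurableSet S) :
    volume ((fun θ : ℝ => A + B * Real.cos θ ^ 2) ⁻¹' S ∩ Set.Ioo 0 (Real.pi / 2)) ≤
      ENNReal.ofReal (1 + 2 * ε / δ) *
        volume ((fun θ : ℝ => C + D * Real.cos θ ^ 2) ⁻¹' S ∩ Set.Ioo 0 (Real.pi / 2)) +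
      (ENNReal.ofReal (Real.pi / 2 * √(δ / B)) + ENNReal.ofReal (Real.pi / 2 * √(δ / B))) := by
  have hδ0 : 0 < δ := by linarith
  have hη : 0 ≤ 1 + 2 * ε / δ := by positivity
  set I := Set.Icc (A + δ) (A + B - δ) with hI
  calc _ ≤ volume (((fun θ : ℝ => A + B * Real.cos θ ^ 2) ⁻¹' (S ∩ I) ∩ Set.Ioo 0 (Real.pi / 2)) ∪
        (((fun θ : ℝ => A + B * Real.cos θ ^ 2) ⁻¹' (Set.Iio (A + δ)) ∩ Set.Ioo 0 (Real.pi / 2)) ∪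
        ((fun θ : ℝ => A + B * Real.cos θ ^ 2) ⁻¹' (Set.Ioi (A + B - δ)) ∩
          Set.Ioo 0 (Real.pi / 2)))) := by
        refine measure_mono ?_
        rintro θ ⟨h1, h2⟩
        by_cases h3 : A + B * Real.cos θ ^ 2 < A + δ
        · exact Or.inr (Or.inl ⟨h3, h2⟩)
        by_cases h4 : A + B - δ < A + B * Real.cos θ ^ 2
        · exact Or.inr (Or.inr ⟨h4, h2⟩)
        · exact Or.inl ⟨⟨h1, not_lt.1 h3, not_lt.1 h4⟩, h2⟩
    _ ≤ _ := by
        refine (measure_union_le _ _).trans (add_le_add ?_ ((measure_union_le _ _).trans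
          (add_le_add (edge1 A B δ hB) (edge2 A B δ hB))))
        rw [vol_eq A B hB _ (hS.inter measurableSet_Icc), vol_eq C D hD S hS,
          ← lintegral_const_mul' _ _ ENNReal.ofReal_ne_top]
        calc _ ≤ ∫⁻ x in S ∩ I, ENNReal.ofReal (dens A B x) :=
              lintegral_mono_set Set.inter_subset_left
          _ ≤ ∫⁻ x in S ∩ I, ENNReal.ofReal (1 + 2 * ε / δ) * ENNReal.ofReal (dens C D x) := by
              refine setLIntegral_mono' (hS.inter measurableSet_Icc) ?_
              rintro x ⟨_, h1, h2⟩
              rw [← ENNReal.ofReal_mul hη]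
              exact ENNReal.ofReal_le_ofReal (dens_le A B C D ε δ x hδ hε hAC hBD h1 h2).1
          _ ≤ _ := by
              refine lintegral_mono_set ?_
              rintro x ⟨h0, h1, h2⟩
              exact ⟨h0, (dens_le A B C D ε δ x hδ hε hAC hBD h1 h2).2⟩

lemma tv_le (A B C D ε δ : ℝ) (hδ : 2 * ε < δ) (hε : 0 ≤ ε) (hB : 0 < B) (hD : 0 < D)
    (hAC : |A - C| ≤ ε) (hBD : |B - D| ≤ ε) :
    tvDist (Measure.map (fun θ : ℝ => A + B * Real.cos θ ^ 2) uniformAngle)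
      (Measure.map (fun θ : ℝ => C + D * Real.cos θ ^ 2) uniformAngle) ≤
      2 * ε / δ + 2 * √(δ / B) := by
  have hpi := Real.pi_pos
  have hδ0 : 0 < δ := by linarith
  have hη : 0 ≤ 2 * ε / δ := by positivity
  have : Nonempty {s : Set ℝ // MeasurableSet s} := ⟨⟨∅, MeasurableSet.empty⟩⟩
  refine ciSup_le ?_
  rintro ⟨S, hS⟩
  simp only
  rw [law_eq A B S hS, law_eq C D S hS]
  have hle : volume ((fun θ : ℝ => C + D * Real.cos θ ^ 2) ⁻¹' S ∩ Set.Ioo 0 (Real.pi / 2)) ≤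
      ENNReal.ofReal (Real.pi / 2) := by
    refine (measure_mono Set.inter_subset_right).trans ?_
    rw [Real.volume_Ioo, sub_zero]
  have hfin := (hle.trans_lt ENNReal.ofReal_lt_top).ne
  have hY : (volume ((fun θ : ℝ => C + D * Real.cos θ ^ 2) ⁻¹' S ∩
      Set.Ioo 0 (Real.pi / 2))).toReal ≤ Real.pi / 2 :=
    ENNReal.toReal_le_of_le_ofReal (by positivity) hle
  have hmain := vol_le A B C D ε δ hδ hε hB hD hAC hBD S hS
  rw [← ENNReal.ofReal_toReal hfin, ← ENNReal.ofReal_mul (by positivity),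
    ← ENNReal.ofReal_add (by positivity) (by positivity),
    ← ENNReal.ofReal_add (by positivity) (by positivity)] at hmain
  have hX := ENNReal.toReal_le_of_le_ofReal (by positivity) hmain
  generalize (volume ((fun θ : ℝ => C + D * Real.cos θ ^ 2) ⁻¹' S ∩
      Set.Ioo 0 (Real.pi / 2))).toReal = y at *
  generalize (volume ((fun θ : ℝ => A + B * Real.cos θ ^ 2) ⁻¹' S ∩
      Set.Ioo 0 (Real.pi / 2))).toReal = x at *
  have h1 : x - y ≤ Real.pi / 2 * (2 * ε / δ + 2 * √(δ / B)) := by nlinarith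
  calc 2 / Real.pi * x - 2 / Real.pi * y = 2 / Real.pi * (x - y) := by ring
    _ ≤ 2 / Real.pi * (Real.pi / 2 * (2 * ε / δ + 2 * √(δ / B))) := by gcongr
    _ = _ := by field_simp

/-- Total variation bound between two shifted arcsine laws (core estimate in the proof of
Lemma 4.3): fix `1 < p < q' < q/2`. For all large `n` and all `0 ≤ A, B, C, D ≤ 1` with
`|A − C|, |B − D| ≤ n^{−q}` and `B, D ≥ n^{−p}`, for a uniform angle `θ` on `[0, 2π)`,
`‖L(A + B cos²θ) − L(C + D cos²θ)‖_TV ≤ 5·10³·n^{2q'−q} + (2/π)·n^{−q'/2}`. -/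
theorem arcsine_tv_bound (p q q' : ℝ) (hp : 1 < p) (hpq' : p < q') (hq'q : q' < q / 2) :
    ∃ N0 : ℕ, ∀ n : ℕ, n > N0 →
      ∀ A B C D : ℝ, 0 ≤ A → A ≤ 1 → 0 ≤ B → B ≤ 1 → 0 ≤ C → C ≤ 1 → 0 ≤ D → D ≤ 1 →
      |A - C| ≤ (n : ℝ) ^ (-q) → |B - D| ≤ (n : ℝ) ^ (-q) →
      (n : ℝ) ^ (-p) ≤ B → (n : ℝ) ^ (-p) ≤ D →
      tvDist (Measure.map (fun θ : ℝ => A + B * Real.cos θ ^ 2) uniformAngle)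
          (Measure.map (fun θ : ℝ => C + D * Real.cos θ ^ 2) uniformAngle) ≤
        5 * 10 ^ 3 * (n : ℝ) ^ (2 * q' - q) + (2 / Real.pi) * (n : ℝ) ^ (-(q' / 2)) := by
  have hpi := Real.pi_pos
  have t1 : Filter.Tendsto (fun n : ℕ => (n : ℝ) ^ (q - 2 * q')) Filter.atTop Filter.atTop :=
    (tendsto_rpow_atTop (by linarith)).comp tendsto_natCast_atTop_atTop
  have t2 : Filter.Tendsto (fun n : ℕ => (n : ℝ) ^ ((q' - p) / 2)) Filter.atTop Filter.atTop :=
    (tendsto_rpow_atTop (by linarith)).comp tendsto_natCast_atTop_atTop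
  obtain ⟨N0, hN0⟩ := Filter.eventually_atTop.1
    ((t1.eventually_gt_atTop 2).and (t2.eventually_ge_atTop Real.pi))
  refine ⟨N0, fun n hn A B C D _ _ _ _ _ _ _ _ hAC hBD hB hD => ?_⟩
  obtain ⟨g1, g2⟩ := hN0 n hn.le
  have hn0 : (0 : ℝ) < n := by
    have : 0 < n := by omega
    exact_mod_cast this
  have hbpos : 0 < (n : ℝ) ^ (-p) := Real.rpow_pos_of_pos hn0 _
  have hεpos : 0 < (n : ℝ) ^ (-q) := Real.rpow_pos_of_pos hn0 _
  have hδpos : 0 < (n : ℝ) ^ (-(2 * q')) := Real.rpow_pos_of_pos hn0 _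
  have hδ : 2 * (n : ℝ) ^ (-q) < (n : ℝ) ^ (-(2 * q')) := by
    have : (n : ℝ) ^ (-(2 * q')) = (n : ℝ) ^ (q - 2 * q') * (n : ℝ) ^ (-q) := by
      rw [← Real.rpow_add hn0]; congr 1; ring
    rw [this]; gcongr
  refine (tv_le A B C D _ _ hδ hεpos.le (hbpos.trans_le hB) (hbpos.trans_le hD) hAC hBD).trans ?_
  refine add_le_add ?_ ?_
  · have : 2 * (n : ℝ) ^ (-q) / (n : ℝ) ^ (-(2 * q')) = 2 * (n : ℝ) ^ (2 * q' - q) := by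
      rw [mul_div_assoc, ← Real.rpow_sub hn0]; congr 2; ring
    rw [this]
    have := Real.rpow_pos_of_pos hn0 (2 * q' - q)
    linarith
  · have h1 : √((n : ℝ) ^ (-(2 * q')) / B) ≤ (n : ℝ) ^ (-q' + p / 2) := by
      refine Real.sqrt_le_iff.2 ⟨(Real.rpow_pos_of_pos hn0 _).le, ?_⟩
      calc _ ≤ (n : ℝ) ^ (-(2 * q')) / (n : ℝ) ^ (-p) := by gcongr
        _ = _ := by
          rw [← Real.rpow_sub hn0, ← Real.rpow_natCast, ← Real.rpow_mul hn0.le]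
          congr 1; push_cast; ring
    have h2 : (n : ℝ) ^ (-(q' / 2)) = (n : ℝ) ^ ((q' - p) / 2) * (n : ℝ) ^ (-q' + p / 2) := by
      rw [← Real.rpow_add hn0]; congr 1; ring
    have h3 := Real.rpow_pos_of_pos hn0 (-q' + p / 2)
    rw [h2, div_mul_eq_mul_div, le_div_iff₀ hpi]
    have h4 := mul_le_mul_of_nonneg_right g2 h3.le
    nlinarith

end
end
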